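/- arXiv:1703.06691 — 2 statements merged into one kernel-verified Lean document; each statement's English description precedes it below -/
import Mathlib

section
/- Let R be a commutative ring and let 𝔸 = (A_1,…,A_a) and 𝔹 = (B_1,…,B_b) be tuples of elements of R. Then Σ_{α ∈ P(a,b)} (−1)^{|α̂^t|} s_α(𝔸) · s_{α̂^t}(𝔹) = Π_{i=1}^{a} Π_{j=1}^{b} (A_i − B_j). -/
open Finset

/-- Complete homogeneous symmetric polynomial `h_k` of a tuple
(sum of all monomials of degree `k`). -/
noncomputable def hh {R : Type*} [CommRing R] {n : ℕ} (A : Fin n → R) (k : ℕ) : R :=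
  ∑ c ∈ Finset.Nat.antidiagonalTuple n k, ∏ i, A i ^ c i

/-- Elementary symmetric polynomial `e_k` of a tuple. -/
noncomputable def ee {R : Type*} [CommRing R] {n : ℕ} (A : Fin n → R) (k : ℕ) : R :=
  ∑ s ∈ Finset.powersetCard k (Finset.univ : Finset (Fin n)), ∏ i ∈ s, A i

/-- `h` with integer index, vanishing for negative index. -/
noncomputable def hZ {R : Type*} [CommRing R] {n : ℕ} (A : Fin n → R) (k : ℤ) : R :=
  if 0 ≤ k then hh A k.toNat else 0

/-- The Schur polynomial of a partition `α` with at most `ℓ` parts, evaluated at a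
tuple, defined via the Jacobi–Trudi formula `s_α = det (h_{α_i + j - i})`. -/
noncomputable def schur {R : Type*} [CommRing R] {n ℓ : ℕ} (A : Fin n → R)
    (α : Fin ℓ → ℕ) : R :=
  Matrix.det (Matrix.of fun i j : Fin ℓ => hZ A ((α i : ℤ) + (j : ℕ) - (i : ℕ)))

/-- `P(a,b)`: partitions with at most `a` parts, each of size at most `b`,
recorded as weakly decreasing functions `Fin a → ℕ` with values `≤ b`. -/
def box (a b : ℕ) : Finset (Fin a → ℕ) :=
  ((Finset.univ : Finset (Fin a → Fin (b + 1))).image fun f i => ((f i : ℕ))).filter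
    fun α => ∀ i j : Fin a, i ≤ j → α j ≤ α i

/-- The transpose of a partition with at most `a` parts, recorded with `b` parts:
`(α^t)_j = #{i | α_i > j}` (0-indexed). -/
def tr {a : ℕ} (b : ℕ) (α : Fin a → ℕ) : Fin b → ℕ :=
  fun j => (Finset.univ.filter fun i : Fin a => (j : ℕ) < α i).card

/-- The complement `α̂` of a partition `α ∈ P(a,b)` inside the `a × b` box:
`α̂_{a+1-j} = b - α_j`. -/
def boxCompl {a : ℕ} (b : ℕ) (α : Fin a → ℕ) : Fin a → ℕ :=
  fun i => b - α i.rev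

/-- `α̂^t ∈ P(b,a)`: the transpose of the complement of `α ∈ P(a,b)`. -/
def compTr (a b : ℕ) (α : Fin a → ℕ) : Fin b → ℕ :=
  tr b (boxCompl b α)

/-- The number of boxes `|α|` of a partition. -/
def wt {a : ℕ} (α : Fin a → ℕ) : ℕ := ∑ i, α i

lemma hh_gf {R : Type*} [CommRing R] {n : ℕ} (A : Fin n → R) :
    PowerSeries.mk (hh A) = ∏ i, PowerSeries.mk (fun k => A i ^ k) := by
  induction n with
  | zero =>
    ext k
    cases k <;> simp [hh, PowerSeries.coeff_one]
  | succ n ih =>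
    rw [Fin.prod_univ_succ, ← ih (fun i => A i.succ)]
    ext k
    rw [PowerSeries.coeff_mk, PowerSeries.coeff_mul]
    simp only [PowerSeries.coeff_mk, hh, Finset.mul_sum]
    rw [Finset.sum_sigma']
    refine Finset.sum_bij' (fun c _ => ⟨(c 0, ∑ i : Fin n, c i.succ), fun i => c i.succ⟩)
      (fun x _ => Fin.cons x.1.1 x.2) ?_ ?_ ?_ ?_ ?_
    · intro c hc
      rw [Finset.Nat.mem_antidiagonalTuple, Fin.sum_univ_succ] at hc
      simp [Finset.Nat.mem_antidiagonalTuple, hc]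
    · rintro ⟨⟨p, q⟩, c⟩ hx
      simp only [Finset.mem_sigma,
        Finset.Nat.mem_antidiagonalTuple] at hx
      have h1 : p + q = k := Finset.HasAntidiagonal.mem_antidiagonal.mp hx.1
      simp [Finset.Nat.mem_antidiagonalTuple, Fin.sum_univ_succ, hx.2, h1]
    · intro c hc
      funext i
      refine Fin.cases ?_ (fun i => ?_) i <;> simp
    · rintro ⟨⟨p, q⟩, c⟩ hx
      simp only [Finset.mem_sigma,
        Finset.Nat.mem_antidiagonalTuple] at hx
      obtain ⟨h1, h2⟩ := hx
      subst h2
      simp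
    · intro c hc
      rw [Fin.prod_univ_succ]

/-- the polynomial `∏_{l ≠ i} (1 - A_l X)` -/
noncomputable def cpoly {R : Type*} [CommRing R] {n : ℕ} (A : Fin n → R) (i : Fin n) :
    Polynomial R :=
  ∏ l ∈ Finset.univ.erase i, (1 - Polynomial.C (A l) * Polynomial.X)

lemma cpoly_coeff {R : Type*} [CommRing R] {n : ℕ} (A : Fin n → R) (i : Fin n) (r : ℕ)
    (hr : n ≤ r) : (cpoly A i).coeff r = 0 := by
  apply Polynomial.coeff_eq_zero_of_natDegree_lt
  have h1 : (cpoly A i).natDegree ≤ ∑ l ∈ Finset.univ.erase i, 1 := by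
    unfold cpoly
    refine (Polynomial.natDegree_prod_le _ _).trans (Finset.sum_le_sum fun l _ => ?_)
    compute_degree
  have h2 := i.pos
  simp at h1
  omega

lemma geom_mul {R : Type*} [CommRing R] (x : R) :
    PowerSeries.mk (fun k => x ^ k) * (1 - PowerSeries.C x * PowerSeries.X) = 1 := by
  ext k
  rw [mul_sub, mul_one, ← mul_assoc]
  cases k with
  | zero => simp
  | succ k =>
    rw [map_sub, PowerSeries.coeff_succ_mul_X, mul_comm _ (PowerSeries.C x),
      PowerSeries.coeff_C_mul]
    simp [PowerSeries.coeff_one, pow_succ']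

lemma hh_mul_cpoly {R : Type*} [CommRing R] {n : ℕ} (A : Fin n → R) (i : Fin n) :
    PowerSeries.mk (hh A) * (cpoly A i : PowerSeries R) = PowerSeries.mk (fun k => A i ^ k) := by
  rw [hh_gf, ← Finset.mul_prod_erase _ _ (Finset.mem_univ i), mul_assoc]
  have : ((cpoly A i : Polynomial R) : PowerSeries R)
      = ∏ l ∈ Finset.univ.erase i, (1 - PowerSeries.C (A l) * PowerSeries.X) := by
    rw [← Polynomial.coeToPowerSeries.ringHom_apply, cpoly, map_prod]
    simp
  rw [this, ← Finset.prod_mul_distrib]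
  simp [geom_mul]

lemma pow_eq_sum {R : Type*} [CommRing R] {n : ℕ} (A : Fin n → R) (i j : Fin n) (t : ℕ) :
    ∑ k : Fin n, hZ A ((t : ℤ) + (k : ℕ) - (j : ℕ)) * (cpoly A i).coeff (n - 1 - k)
      = A i ^ (t + (n - 1 - j)) := by
  have h := congrArg (PowerSeries.coeff (t + (n - 1 - j))) (hh_mul_cpoly A i)
  rw [PowerSeries.coeff_mk, mul_comm, PowerSeries.coeff_mul,
    Finset.Nat.sum_antidiagonal_eq_sum_range_succ_mk] at h
  rw [← h]
  simp only [PowerSeries.coeff_mk, Polynomial.coeff_coe]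
  have hj := j.isLt
  set m := t + (n - 1 - j) with hm
  have e1 : ∑ k : Fin n, hZ A ((t : ℤ) + (k : ℕ) - (j : ℕ)) * (cpoly A i).coeff (n - 1 - k)
      = ∑ r ∈ Finset.range n, (cpoly A i).coeff r * hZ A ((m : ℤ) - r) := by
    rw [← Fin.sum_univ_eq_sum_range (fun r => (cpoly A i).coeff r * hZ A ((m : ℤ) - r)),
      ← Equiv.sum_comp Fin.revPerm]
    refine Finset.sum_congr rfl fun k _ => ?_
    have hk := k.isLt
    rw [mul_comm]
    congr 2
    · simp; omega
    · simp; omega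
  rw [e1]
  have e2 : ∑ r ∈ Finset.range n, (cpoly A i).coeff r * hZ A ((m : ℤ) - r)
      = ∑ r ∈ Finset.range (n + m + 1), (cpoly A i).coeff r * hZ A ((m : ℤ) - r) := by
    apply Finset.sum_subset
    · intro x; simp; omega
    · intro x _ hx
      rw [cpoly_coeff A i x (by simpa using hx), zero_mul]
  have e3 : ∑ r ∈ Finset.range m.succ, (cpoly A i).coeff r * hh A (m - r)
      = ∑ r ∈ Finset.range m.succ, (cpoly A i).coeff r * hZ A ((m : ℤ) - r) := by
    refine Finset.sum_congr rfl fun r hr => ?_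
    simp only [Finset.mem_range] at hr
    rw [hZ, if_pos (by omega)]
    congr 2
    omega
  rw [e2, e3]
  symm
  apply Finset.sum_subset
  · intro x; simp; omega
  · intro x _ hx
    simp only [Finset.mem_range] at hx
    rw [hZ, if_neg (by omega), mul_zero]

/-- descending Vandermonde determinant -/
noncomputable def vdm {R : Type*} [CommRing R] {n : ℕ} (A : Fin n → R) : R :=
  Matrix.det (Matrix.of fun j i : Fin n => A i ^ (n - 1 - (j : ℕ)))

lemma schur_zero {R : Type*} [CommRing R] {n l : ℕ} (A : Fin n → R) :
    schur A (fun _ : Fin l => 0) = 1 := by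
  unfold schur
  rw [Matrix.det_of_isUpperTriangular]
  · apply Finset.prod_eq_one
    intro i _
    simp [hZ, hh, Finset.Nat.antidiagonalTuple_zero_right]
  · intro i j hij
    simp only [id] at hij
    have : (j : ℕ) < i := hij
    simp only [Matrix.of_apply]
    rw [hZ, if_neg (by push_cast; omega)]

lemma schur_mul_vdm {R : Type*} [CommRing R] {n : ℕ} (A : Fin n → R) (α : Fin n → ℕ) :
    schur A α * vdm A
      = Matrix.det (Matrix.of fun j i : Fin n => A i ^ (α j + (n - 1 - (j : ℕ)))) := by
  have key : ∀ α : Fin n → ℕ, schur A α *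
      Matrix.det (Matrix.of fun k i : Fin n => (cpoly A i).coeff (n - 1 - k))
      = Matrix.det (Matrix.of fun j i : Fin n => A i ^ (α j + (n - 1 - (j : ℕ)))) := by
    intro α
    rw [schur, ← Matrix.det_mul]
    congr 1
    ext j i
    rw [Matrix.mul_apply]
    simp only [Matrix.of_apply]
    exact pow_eq_sum A i j (α j)
  have h0 := key (fun _ => 0)
  rw [schur_zero, one_mul] at h0
  simp only [zero_add] at h0
  rw [← key, h0, vdm]

lemma vdm_eq {R : Type*} [CommRing R] {n : ℕ} (A : Fin n → R) :
    vdm A = ∏ i : Fin n, ∏ j : Fin n, if i < j then A i - A j else 1 := by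
  have h := Matrix.det_projVandermonde (1 : Fin n → R) A
  rw [← Matrix.det_transpose] at h
  have e : vdm A = (Matrix.projVandermonde (1 : Fin n → R) A).transpose.det := by
    unfold vdm
    congr 1
    ext j i
    simp only [Matrix.of_apply, Matrix.transpose_apply, Matrix.projVandermonde_apply, Pi.one_apply,
      one_pow, one_mul, Fin.val_rev]
    congr 1
    omega
  rw [e, h]
  refine Finset.prod_congr rfl fun i _ => ?_
  rw [← Finset.prod_filter]
  refine Finset.prod_congr ?_ fun j _ => by simp
  ext j; simp

lemma vdm_append {R : Type*} [CommRing R] {a b : ℕ} (A : Fin a → R) (B : Fin b → R) :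
    vdm (Fin.append A B) = vdm A * vdm B * ∏ i, ∏ j, (A i - B j) := by
  simp only [vdm_eq, Fin.prod_univ_add, Fin.append_left, Fin.append_right]
  have h1 : ∀ (i : Fin a) (j : Fin b), Fin.castAdd b i < Fin.natAdd a j := by
    intro i j; rw [Fin.lt_def, Fin.val_natAdd, Fin.val_castAdd]; omega
  have h2 : ∀ (i : Fin a) (j : Fin b), ¬ Fin.natAdd a j < Fin.castAdd b i := by
    intro i j; rw [Fin.lt_def, Fin.val_natAdd, Fin.val_castAdd]; omega
  have h3 : ∀ (i j : Fin a), Fin.castAdd b i < Fin.castAdd b j ↔ i < j := by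
    intro i j; exact Iff.rfl
  have h4 : ∀ (i j : Fin b), Fin.natAdd a i < Fin.natAdd a j ↔ i < j := by
    intro i j; simp
  simp only [h1, h2, h3, h4, if_true, if_false, Finset.prod_mul_distrib, Finset.prod_const_one]
  ring

lemma mem_box {a b : ℕ} (α : Fin a → ℕ) :
    α ∈ box a b ↔ (∀ i, α i ≤ b) ∧ ∀ i j : Fin a, i ≤ j → α j ≤ α i := by
  unfold _root_.box
  rw [Finset.mem_filter, Finset.mem_image]
  refine and_congr_left fun _ => ⟨?_, ?_⟩
  · rintro ⟨f, -, rfl⟩ i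
    exact Nat.lt_succ_iff.mp (f i).isLt
  · intro h
    exact ⟨fun i => ⟨α i, Nat.lt_succ_of_le (h i)⟩, Finset.mem_univ _, rfl⟩

lemma compTr_eq {a b : ℕ} (α : Fin a → ℕ) (j : Fin b) :
    compTr a b α j = (Finset.univ.filter fun i : Fin a => α i + j < b).card := by
  unfold compTr tr boxCompl
  refine Finset.card_bij' (fun i _ => i.rev) (fun i _ => i.rev) ?_ ?_ ?_ ?_
  · intro i; simp; omega
  · intro i; simp; omega
  · simp
  · simp

lemma compTr_le {a b : ℕ} (α : Fin a → ℕ) (j : Fin b) : compTr a b α j ≤ a := by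
  rw [compTr_eq]
  exact (Finset.card_le_univ _).trans (by simp)

lemma compTr_anti {a b : ℕ} (α : Fin a → ℕ) (j k : Fin b) (h : j ≤ k) :
    compTr a b α k ≤ compTr a b α j := by
  rw [compTr_eq, compTr_eq]
  apply Finset.card_le_card
  intro i
  have : (j : ℕ) ≤ k := h
  simp
  omega

lemma compTr_lower {a b : ℕ} {α : Fin a → ℕ} (hα : α ∈ box a b) (i : Fin a) (j : Fin b)
    (h : α i + j < b) : a - i ≤ compTr a b α j := by
  rw [compTr_eq, ← Fin.card_Ici]
  apply Finset.card_le_card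
  intro k hk
  have := ((mem_box α).mp hα).2 i k (by simpa using hk)
  simp
  omega

lemma compTr_upper {a b : ℕ} {α : Fin a → ℕ} (hα : α ∈ box a b) (i : Fin a) (j : Fin b)
    (h : b ≤ α i + j) : compTr a b α j ≤ a - 1 - i := by
  rw [compTr_eq, ← Fin.card_Ioi]
  apply Finset.card_le_card
  intro k hk
  simp only [Finset.mem_filter, Finset.mem_univ, true_and] at hk
  rw [Finset.mem_Ioi]
  by_contra hc
  have := ((mem_box α).mp hα).2 k i (not_lt.mp hc)
  omega

/-- position function -/
def pos (a b : ℕ) (α : Fin a → ℕ) : Fin (a + b) → Fin (a + b) :=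
  Fin.addCases (fun i => ⟨b + i - α i, by omega⟩) (fun j => ⟨a + j - compTr a b α j, by omega⟩)

lemma pos_left {a b : ℕ} (α : Fin a → ℕ) (i : Fin a) :
    ((pos a b α (Fin.castAdd b i) : Fin (a + b)) : ℕ) = b + i - α i := by
  simp [pos]

lemma pos_right {a b : ℕ} (α : Fin a → ℕ) (j : Fin b) :
    ((pos a b α (Fin.natAdd a j) : Fin (a + b)) : ℕ) = a + j - compTr a b α j := by
  simp [pos]

lemma pos_left_lt {a b : ℕ} {α : Fin a → ℕ} (hα : α ∈ box a b) {i j : Fin a} (h : i < j) :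
    pos a b α (Fin.castAdd b i) < pos a b α (Fin.castAdd b j) := by
  rw [Fin.lt_def, pos_left, pos_left]
  have h1 := ((mem_box α).mp hα).2 i j h.le
  have h2 := ((mem_box α).mp hα).1 i
  have h3 : (i : ℕ) < j := h
  omega

lemma pos_right_lt {a b : ℕ} (α : Fin a → ℕ) {i j : Fin b} (h : i < j) :
    pos a b α (Fin.natAdd a i) < pos a b α (Fin.natAdd a j) := by
  rw [Fin.lt_def, pos_right, pos_right]
  have h1 := compTr_anti α i j h.le
  have h2 := compTr_le α i
  have h3 : (i : ℕ) < j := h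
  omega

lemma pos_cross_lt {a b : ℕ} {α : Fin a → ℕ} (hα : α ∈ box a b) (i : Fin a) (j : Fin b)
    (h : b ≤ α i + j) : pos a b α (Fin.castAdd b i) < pos a b α (Fin.natAdd a j) := by
  rw [Fin.lt_def, pos_left, pos_right]
  have h1 := compTr_upper hα i j h
  omega

lemma pos_cross_gt {a b : ℕ} {α : Fin a → ℕ} (hα : α ∈ box a b) (i : Fin a) (j : Fin b)
    (h : α i + j < b) : pos a b α (Fin.natAdd a j) < pos a b α (Fin.castAdd b i) := by
  rw [Fin.lt_def, pos_left, pos_right]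
  have h1 := compTr_lower hα i j h
  omega

lemma pos_cross_ne {a b : ℕ} {α : Fin a → ℕ} (hα : α ∈ box a b) (i : Fin a) (j : Fin b) :
    pos a b α (Fin.castAdd b i) ≠ pos a b α (Fin.natAdd a j) := by
  rcases lt_or_ge (α i + j) b with h | h
  · exact (pos_cross_gt hα i j h).ne'
  · exact (pos_cross_lt hα i j h).ne

lemma pos_inj {a b : ℕ} {α : Fin a → ℕ} (hα : α ∈ box a b) :
    Function.Injective (pos a b α) := by
  intro x y
  refine Fin.addCases (fun i => ?_) (fun i => ?_) x <;>
    refine Fin.addCases (fun j => ?_) (fun j => ?_) y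
  · intro h
    rcases lt_trichotomy i j with h' | h' | h'
    · exact absurd h (pos_left_lt hα h').ne
    · rw [h']
    · exact absurd h (pos_left_lt hα h').ne'
  · intro h
    exact absurd h (pos_cross_ne hα i j)
  · intro h
    exact absurd h.symm (pos_cross_ne hα j i)
  · intro h
    rcases lt_trichotomy i j with h' | h' | h'
    · exact absurd h (pos_right_lt α h').ne
    · rw [h']
    · exact absurd h (pos_right_lt α h').ne'

open Classical in
/-- the Grassmannian permutation attached to `α` -/
noncomputable def gperm (a b : ℕ) (α : Fin a → ℕ) : Equiv.Perm (Fin (a + b)) :=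
  if h : Function.Bijective (pos a b α) then Equiv.ofBijective _ h else 1

lemma gperm_apply {a b : ℕ} {α : Fin a → ℕ} (hα : α ∈ box a b) (x : Fin (a + b)) :
    gperm a b α x = pos a b α x := by
  have h : Function.Bijective (pos a b α) := Finite.injective_iff_bijective.mp (pos_inj hα)
  rw [gperm, dif_pos h]
  rfl

lemma sign_gperm {a b : ℕ} {α : Fin a → ℕ} (hα : α ∈ box a b) :
    (gperm a b α).sign = (-1) ^ wt (compTr a b α) := by
  have e : ∀ i : Fin (a + b), ∏ j ∈ Finset.Ioi i,
      (if gperm a b α i < gperm a b α j then (1 : ℤˣ) else -1)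
      = ∏ j, if i < j then (if pos a b α i < pos a b α j then (1 : ℤˣ) else -1) else 1 := by
    intro i
    rw [← Finset.prod_filter]
    simp only [gperm_apply hα]
    refine Finset.prod_congr ?_ fun j _ => rfl
    ext j; simp
  rw [Equiv.Perm.sign_eq_prod_prod_Ioi]
  simp only [e, Fin.prod_univ_add]
  have h1 : ∀ (i : Fin a) (j : Fin b), Fin.castAdd b i < Fin.natAdd a j := by
    intro i j; rw [Fin.lt_def, Fin.val_natAdd, Fin.val_castAdd]; omega
  have h2 : ∀ (i : Fin a) (j : Fin b), ¬ Fin.natAdd a j < Fin.castAdd b i := by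
    intro i j; rw [Fin.lt_def, Fin.val_natAdd, Fin.val_castAdd]; omega
  have h3 : ∀ (i j : Fin a), (if Fin.castAdd b i < Fin.castAdd b j then
      (if pos a b α (Fin.castAdd b i) < pos a b α (Fin.castAdd b j) then (1 : ℤˣ) else -1)
        else 1) = 1 := by
    intro i j
    split_ifs with h h'
    · rfl
    · exact absurd (pos_left_lt hα h) h'
    · rfl
  have h4 : ∀ (i j : Fin b), (if Fin.natAdd a i < Fin.natAdd a j then
      (if pos a b α (Fin.natAdd a i) < pos a b α (Fin.natAdd a j) then (1 : ℤˣ) else -1)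
        else 1) = 1 := by
    intro i j
    split_ifs with h h'
    · rfl
    · exact absurd (pos_right_lt α (by simpa using h)) h'
    · rfl
  have h5 : ∀ (i : Fin a) (j : Fin b),
      (if pos a b α (Fin.castAdd b i) < pos a b α (Fin.natAdd a j) then (1 : ℤˣ) else -1)
        = if α i + j < b then -1 else 1 := by
    intro i j
    split_ifs with h h' h'
    · exact absurd h (pos_cross_gt hα i j h').not_gt
    · rfl
    · rfl
    · exact absurd (pos_cross_lt hα i j (not_lt.mp h')) h
  simp only [h1, h2, h3, h4, h5, if_true, if_false, Finset.prod_const_one, one_mul, mul_one]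
  rw [Finset.prod_comm, wt, ← Finset.prod_pow_eq_pow_sum]
  refine Finset.prod_congr rfl fun j _ => ?_
  rw [compTr_eq, ← Finset.prod_filter, Finset.prod_const]

/-- block permutation -/
def blk {a b : ℕ} (p : Equiv.Perm (Fin a)) (q : Equiv.Perm (Fin b)) : Equiv.Perm (Fin (a + b)) :=
  finSumFinEquiv.permCongr (Equiv.Perm.sumCongr p q)

lemma blk_left {a b : ℕ} (p : Equiv.Perm (Fin a)) (q : Equiv.Perm (Fin b)) (i : Fin a) :
    blk p q (Fin.castAdd b i) = Fin.castAdd b (p i) := by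
  simp [blk, Equiv.permCongr_apply]

lemma blk_right {a b : ℕ} (p : Equiv.Perm (Fin a)) (q : Equiv.Perm (Fin b)) (i : Fin b) :
    blk p q (Fin.natAdd a i) = Fin.natAdd a (q i) := by
  simp [blk, Equiv.permCongr_apply]

lemma sign_blk {a b : ℕ} (p : Equiv.Perm (Fin a)) (q : Equiv.Perm (Fin b)) :
    (blk p q).sign = p.sign * q.sign := by
  rw [blk, Equiv.Perm.sign_permCongr, Equiv.Perm.sign_sumCongr]

lemma exists_blk {a b : ℕ} (τ : Equiv.Perm (Fin (a + b)))
    (h : ∀ i : Fin a, ∃ k : Fin a, τ (Fin.castAdd b i) = Fin.castAdd b k) :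
    ∃ p q, blk p q = τ := by
  have := Equiv.Perm.mem_sumCongrHom_range_of_perm_mapsTo_inl
    (σ := (finSumFinEquiv (m := a) (n := b)).symm.permCongr τ) (by
      rintro _ ⟨i, rfl⟩
      obtain ⟨k, hk⟩ := h i
      refine ⟨k, ?_⟩
      simp [Equiv.permCongr_apply, hk])
  obtain ⟨⟨p, q⟩, hpq⟩ := this
  refine ⟨p, q, ?_⟩
  have h2 : Equiv.Perm.sumCongr p q = (finSumFinEquiv (m := a) (n := b)).symm.permCongr τ := hpq
  rw [blk, h2]
  ext x
  simp [Equiv.permCongr_apply]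

lemma strictMono_gap {a N : ℕ} {f : Fin a → Fin N} (hf : StrictMono f) (i j : Fin a) (h : i ≤ j) :
    (f i : ℕ) + (j - i) ≤ f j := by
  obtain ⟨j, hj⟩ := j
  induction j with
  | zero =>
    have : i = ⟨0, hj⟩ := le_antisymm h (by simp [Fin.le_def])
    subst this; simp
  | succ j ih =>
    rcases h.eq_or_lt with h | h
    · subst h; simp
    · have h' : (i : ℕ) < j + 1 := h
      have h1 := ih (by omega) (by rw [Fin.le_def]; simp; omega)
      have h2 : f ⟨j, by omega⟩ < f ⟨j + 1, hj⟩ := hf (by simp [Fin.lt_def])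
      rw [Fin.lt_def] at h2
      simp only at h1 ⊢
      omega

lemma exists_decomp {a b : ℕ} (σ : Equiv.Perm (Fin (a + b))) :
    ∃ α ∈ box a b, ∃ p q, gperm a b α * blk p q = σ := by
  let S : Finset (Fin (a + b)) := Finset.univ.image fun i : Fin a => σ (Fin.castAdd b i)
  have hS : S.card = a := by
    rw [Finset.card_image_of_injective]
    · simp
    · exact σ.injective.comp (Fin.castAdd_injective a b)
  let g := S.orderEmbOfFin hS
  have hg : StrictMono g := (S.orderEmbOfFin hS).strictMono
  have hlo : ∀ i : Fin a, (i : ℕ) ≤ g i := by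
    intro i
    have := strictMono_gap hg ⟨0, i.pos⟩ i (by simp [Fin.le_def])
    simp only at this
    omega
  have hhi : ∀ i : Fin a, (g i : ℕ) ≤ b + i := by
    intro i
    have hi := i.isLt
    have := strictMono_gap hg i ⟨a - 1, by omega⟩ (by rw [Fin.le_def]; simp; omega)
    have h2 := (g ⟨a - 1, by omega⟩).isLt
    simp only at this
    omega
  have hα : (fun i : Fin a => b + i - (g i : ℕ)) ∈ box a b := by
    rw [mem_box]
    refine ⟨fun i => ?_, fun i j hij => ?_⟩
    · have := hlo i
      omega
    · have := strictMono_gap hg i j hij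
      have h3 : (i : ℕ) ≤ j := hij
      omega
  refine ⟨_, hα, ?_⟩
  set α := (fun i : Fin a => b + i - (g i : ℕ)) with hαd
  have hgp : ∀ i, gperm a b α (Fin.castAdd b i) = g i := by
    intro i
    rw [gperm_apply hα]
    ext
    rw [pos_left]
    have := hhi i
    simp only [hαd]
    omega
  obtain ⟨p, q, hpq⟩ := exists_blk ((gperm a b α)⁻¹ * σ) (by
    intro i
    have hm : σ (Fin.castAdd b i) ∈ S := Finset.mem_image_of_mem _ (Finset.mem_univ i)
    have : σ (Fin.castAdd b i) ∈ Set.range g := by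
      rw [Finset.range_orderEmbOfFin]
      exact hm
    obtain ⟨k, hk⟩ := this
    refine ⟨k, ?_⟩
    rw [Equiv.Perm.mul_apply, ← hk, ← hgp k]
    exact (gperm a b α).symm_apply_apply _)
  refine ⟨p, q, ?_⟩
  rw [hpq, mul_inv_cancel_left]

lemma decomp_inj {a b : ℕ} {α α' : Fin a → ℕ} (hα : α ∈ box a b) (hα' : α' ∈ box a b)
    {p p' : Equiv.Perm (Fin a)} {q q' : Equiv.Perm (Fin b)}
    (h : gperm a b α * blk p q = gperm a b α' * blk p' q') : α = α' ∧ p = p' ∧ q = q' := by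
  have key : α = α' := by
    have hm : ∀ {β : Fin a → ℕ}, β ∈ box a b →
        StrictMono (fun i => pos a b β (Fin.castAdd b i)) := fun hβ i j hij => pos_left_lt hβ hij
    have hr : ∀ {β : Fin a → ℕ} (_ : β ∈ box a b) (r : Equiv.Perm (Fin a)) (s : Equiv.Perm (Fin b)),
        Set.range (fun i => pos a b β (Fin.castAdd b i))
          = Set.range (fun i => (gperm a b β * blk r s) (Fin.castAdd b i)) := by
      intro β hβ r s
      rw [← r.surjective.range_comp]
      congr 1
      funext i
      simp [Equiv.Perm.mul_apply, blk_left, gperm_apply hβ]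
    have h1 : (fun i => pos a b α (Fin.castAdd b i)) = fun i => pos a b α' (Fin.castAdd b i) := by
      rw [← StrictMono.range_inj (hm hα) (hm hα'), hr hα p q, hr hα' p' q', h]
    funext i
    have h2 := congrArg Fin.val (congrFun h1 i)
    simp only [pos_left] at h2
    have := ((mem_box α).mp hα).1 i
    have := ((mem_box α').mp hα').1 i
    omega
  subst key
  have h2 := mul_left_cancel h
  refine ⟨rfl, ?_, ?_⟩
  · ext i
    have := congrArg Fin.val (Equiv.congr_fun h2 (Fin.castAdd b i))
    simpa [blk_left] using this
  · ext i
    have := congrArg Fin.val (Equiv.congr_fun h2 (Fin.natAdd a i))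
    simpa [blk_right] using this

lemma laplace {R : Type*} [CommRing R] {a b : ℕ} (A : Fin a → R) (B : Fin b → R) :
    ∑ α ∈ box a b, (-1 : R) ^ wt (compTr a b α)
        * Matrix.det (Matrix.of fun j i : Fin a => A i ^ (α j + (a - 1 - (j : ℕ))))
        * Matrix.det (Matrix.of fun j i : Fin b => B i ^ (compTr a b α j + (b - 1 - (j : ℕ))))
      = vdm (Fin.append A B) := by
  simp only [vdm, Matrix.det_apply']
  have e : ∀ α ∈ box a b, (-1 : R) ^ wt (compTr a b α)
        * (∑ p : Equiv.Perm (Fin a), ((p.sign : ℤ) : R) *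
          ∏ i, (Matrix.of fun j i : Fin a => A i ^ (α j + (a - 1 - (j : ℕ)))) (p i) i)
        * (∑ q : Equiv.Perm (Fin b), ((q.sign : ℤ) : R) *
          ∏ i, (Matrix.of fun j i : Fin b =>
            B i ^ (compTr a b α j + (b - 1 - (j : ℕ)))) (q i) i)
      = ∑ x : Equiv.Perm (Fin a) × Equiv.Perm (Fin b),
        (((gperm a b α * blk x.1 x.2).sign : ℤ) : R) * ∏ r, (Matrix.of fun j i : Fin (a + b) =>
          Fin.append A B i ^ (a + b - 1 - (j : ℕ))) ((gperm a b α * blk x.1 x.2) r) r := by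
    intro α hα
    rw [mul_assoc, Finset.sum_mul_sum, ← Finset.sum_product', Finset.mul_sum,
      Finset.univ_product_univ]
    refine Finset.sum_congr rfl fun x _ => ?_
    rw [Fin.prod_univ_add, Equiv.Perm.sign_mul, sign_gperm hα, sign_blk]
    have hA : ∏ i, (Matrix.of fun j i : Fin a => A i ^ (α j + (a - 1 - (j : ℕ)))) (x.1 i) i
        = ∏ i : Fin a, (Matrix.of fun j i : Fin (a + b) =>
          Fin.append A B i ^ (a + b - 1 - (j : ℕ))) ((gperm a b α * blk x.1 x.2)
            (Fin.castAdd b i)) (Fin.castAdd b i) := by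
      refine Finset.prod_congr rfl fun i _ => ?_
      simp only [Matrix.of_apply, Equiv.Perm.mul_apply, blk_left, Fin.append_left, gperm_apply hα,
        pos_left]
      congr 1
      have := ((mem_box α).mp hα).1 (x.1 i)
      omega
    have hB : ∏ i, (Matrix.of fun j i : Fin b =>
            B i ^ (compTr a b α j + (b - 1 - (j : ℕ)))) (x.2 i) i
        = ∏ i : Fin b, (Matrix.of fun j i : Fin (a + b) =>
          Fin.append A B i ^ (a + b - 1 - (j : ℕ))) ((gperm a b α * blk x.1 x.2)
            (Fin.natAdd a i)) (Fin.natAdd a i) := by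
      refine Finset.prod_congr rfl fun i _ => ?_
      simp only [Matrix.of_apply, Equiv.Perm.mul_apply, blk_right, Fin.append_right,
        gperm_apply hα, pos_right]
      congr 1
      have := compTr_le α (x.2 i)
      omega
    rw [hA, hB]
    push_cast
    ring
  rw [Finset.sum_congr rfl e, ← Finset.sum_product']
  refine Finset.sum_bij (fun x _ => gperm a b x.1 * blk x.2.1 x.2.2) ?_ ?_ ?_ ?_
  · intros; exact Finset.mem_univ _
  · rintro ⟨α, p, q⟩ h1 ⟨α', p', q'⟩ h2 h
    obtain ⟨rfl, rfl, rfl⟩ := decomp_inj (Finset.mem_product.mp h1).1 (Finset.mem_product.mp h2).1 h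
    rfl
  · intro σ _
    obtain ⟨α, hα, p, q, h⟩ := exists_decomp σ
    exact ⟨(α, p, q), Finset.mem_product.mpr ⟨hα, Finset.mem_univ _⟩, h⟩
  · intros; rfl

lemma vdm_mul_statement {R : Type*} [CommRing R] {a b : ℕ} (A : Fin a → R) (B : Fin b → R) :
    (vdm A * vdm B) * ∑ α ∈ box a b,
        (-1 : R) ^ wt (compTr a b α) * schur A α * schur B (compTr a b α)
      = (vdm A * vdm B) * ∏ i, ∏ j, (A i - B j) := by
  rw [← vdm_append, ← laplace, Finset.mul_sum]
  refine Finset.sum_congr rfl fun α _ => ?_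
  rw [← schur_mul_vdm, ← schur_mul_vdm]
  ring

lemma vdm_ne_zero {R : Type*} [CommRing R] [IsDomain R] {n : ℕ} (A : Fin n → R)
    (hA : Function.Injective A) : vdm A ≠ 0 := by
  rw [vdm_eq]
  refine Finset.prod_ne_zero_iff.mpr fun i _ => Finset.prod_ne_zero_iff.mpr fun j _ => ?_
  split_ifs with h
  · exact sub_ne_zero.mpr fun h' => h.ne (hA h')
  · exact one_ne_zero

lemma map_schur {R S : Type*} [CommRing R] [CommRing S] (f : R →+* S) {n l : ℕ} (A : Fin n → R)
    (α : Fin l → ℕ) : f (schur A α) = schur (fun i => f (A i)) α := by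
  unfold schur
  rw [RingHom.map_det]
  congr 1
  ext i j
  simp only [RingHom.mapMatrix_apply, Matrix.map_apply, Matrix.of_apply, hZ]
  split_ifs
  · simp [hh]
  · simp

/-- `Σ_{α ∈ P(a,b)} (−1)^{|α̂^t|} s_α(𝔸) s_{α̂^t}(𝔹) = Π_i Π_j (A_i − B_j)`. -/
theorem statement0 {R : Type*} [CommRing R] {a b : ℕ} (A : Fin a → R) (B : Fin b → R) :
    ∑ α ∈ box a b,
        (-1 : R) ^ wt (compTr a b α) * schur A α * schur B (compTr a b α)
      = ∏ i, ∏ j, (A i - B j) := by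
  have h : ∑ α ∈ box a b, (-1 : MvPolynomial (Fin a ⊕ Fin b) ℤ) ^ wt (compTr a b α)
        * schur (fun i => MvPolynomial.X (Sum.inl i)) α
        * schur (fun j => MvPolynomial.X (Sum.inr j)) (compTr a b α)
      = ∏ i : Fin a, ∏ j : Fin b, (MvPolynomial.X (Sum.inl i) - MvPolynomial.X (Sum.inr j)) := by
    refine mul_left_cancel₀ ?_ (vdm_mul_statement _ _)
    exact mul_ne_zero
      (vdm_ne_zero _ ((MvPolynomial.X_injective).comp Sum.inl_injective))
      (vdm_ne_zero _ ((MvPolynomial.X_injective).comp Sum.inr_injective))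
  have h2 := congrArg (MvPolynomial.eval₂Hom (Int.castRingHom R) (Sum.elim A B)) h
  simpa only [map_sum, map_mul, map_pow, map_neg, map_one, map_prod, map_sub, map_schur,
    MvPolynomial.eval₂Hom_X', Sum.elim_inl, Sum.elim_inr] using h2
end

section
/- Let R be a commutative ring, let 𝔸 = (A_1,…,A_a), 𝔹 = (B_1,…,B_b) and 𝕏 = (X_1,…,X_x) be tuples of elements of R, and let 𝔹 ⊔ 𝕏 denote the concatenated tuple of length b + x. Writing r(𝔸,ℂ) = Σ_{α ∈ P(a,c)} (−1)^{|α̂^t|} s_α(𝔸) · s_{α̂^t}(ℂ) for any tuple ℂ of length c, one has r(𝔸, 𝔹 ⊔ 𝕏) = r(𝔸, 𝔹) · r(𝔸, 𝕏). -/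
open Finset

/-- `r(𝔸,𝔹) = Σ_{α ∈ P(a,b)} (−1)^{|α̂^t|} s_α(𝔸) · s_{α̂^t}(𝔹)`. -/
noncomputable def rpoly {R : Type*} [CommRing R] {a b : ℕ} (A : Fin a → R) (B : Fin b → R) : R :=
  ∑ α ∈ box a b, (-1 : R) ^ wt (compTr a b α) * schur A α * schur B (compTr a b α)


/-! ### Generating functions -/

/-- The polynomial `∏ (1 - A_i z)`. -/
noncomputable def EE {R : Type*} [CommRing R] {n : ℕ} (A : Fin n → R) : Polynomial R :=
  ∏ i, (1 - Polynomial.C (A i) * Polynomial.X)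

lemma natDegree_EE_le {R : Type*} [CommRing R] {n : ℕ} (A : Fin n → R) :
    (EE A).natDegree ≤ n := by
  unfold EE
  refine (Polynomial.natDegree_prod_le _ _).trans ?_
  refine (Finset.sum_le_card_nsmul _ _ 1 ?_).trans (by simp)
  intro i _
  compute_degree

lemma EE_append {R : Type*} [CommRing R] {b x : ℕ} (B : Fin b → R) (X : Fin x → R) :
    EE (Fin.append B X) = EE B * EE X := by
  simp [EE, Fin.prod_univ_add]

lemma hh_succ {R : Type*} [CommRing R] {n : ℕ} (A : Fin (n + 1) → R) (k : ℕ) :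
    hh A k = ∑ p ∈ Finset.HasAntidiagonal.antidiagonal k, A 0 ^ p.1 * hh (fun i => A i.succ) p.2 := by
  unfold hh
  simp_rw [Finset.mul_sum]
  rw [Finset.sum_sigma']
  refine Finset.sum_bij' (fun c _ => ⟨(c 0, ∑ i : Fin n, c i.succ), fun i => c i.succ⟩)
    (fun p _ => Fin.cons p.1.1 p.2) ?_ ?_ ?_ ?_ ?_
  · intro c hc
    rw [Finset.Nat.mem_antidiagonalTuple, Fin.sum_univ_succ] at hc
    simp [Finset.Nat.mem_antidiagonalTuple, hc]
  · rintro ⟨⟨p, q⟩, c⟩ h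
    simp only [Finset.mem_sigma, Finset.HasAntidiagonal.mem_antidiagonal, Finset.Nat.mem_antidiagonalTuple] at h
    simp [Finset.Nat.mem_antidiagonalTuple, Fin.sum_univ_succ, h]
  · intro c _
    exact Fin.cons_self_tail c
  · rintro ⟨⟨p, q⟩, c⟩ h
    simp only [Finset.mem_sigma, Finset.HasAntidiagonal.mem_antidiagonal, Finset.Nat.mem_antidiagonalTuple] at h
    simp [h]
  · intro c _
    simp [Fin.prod_univ_succ]

lemma HH_mul_EE {R : Type*} [CommRing R] {n : ℕ} (A : Fin n → R) :
    (PowerSeries.mk (hh A)) * ((EE A : Polynomial R) : PowerSeries R) = 1 := by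
  induction n with
  | zero =>
    have : PowerSeries.mk (hh A) = 1 := by
      ext k
      rw [PowerSeries.coeff_mk, PowerSeries.coeff_one]
      cases k <;> simp [hh]
    simp [this, EE]
  | succ n ih =>
    have h1 : PowerSeries.mk (hh A) =
        PowerSeries.mk (fun k => A 0 ^ k) * PowerSeries.mk (hh (fun i => A i.succ)) := by
      ext k
      rw [PowerSeries.coeff_mul]
      simp [hh_succ]
    have h2 : EE A = (1 - Polynomial.C (A 0) * Polynomial.X) * EE (fun i => A i.succ) := by
      simp [EE, Fin.prod_univ_succ]
    have h3 : PowerSeries.mk (fun k => A 0 ^ k) *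
        (((1 - Polynomial.C (A 0) * Polynomial.X : Polynomial R)) : PowerSeries R) = 1 := by
      ext k
      cases k <;> simp [mul_sub, PowerSeries.coeff_one, PowerSeries.coeff_succ_mul_X, ← mul_assoc, pow_succ]
    rw [h1, h2, Polynomial.coe_mul]
    calc _ = (PowerSeries.mk (fun k => A 0 ^ k) *
        (((1 - Polynomial.C (A 0) * Polynomial.X : Polynomial R)) : PowerSeries R)) *
        (PowerSeries.mk (hh (fun i => A i.succ)) * (EE (fun i => A i.succ) : PowerSeries R)) := by ring
      _ = 1 := by rw [h3, ih, one_mul]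

/-! ### Resultants with formal degrees -/

lemma res_mul_left {R : Type*} [CommRing R] (f₁ f₂ g : Polynomial R) {m₁ m₂ n : ℕ}
    (h1 : f₁.natDegree ≤ m₁) (h2 : f₂.natDegree ≤ m₂) (hg : g.natDegree ≤ n) :
    Polynomial.resultant (f₁ * f₂) g (m₁ + m₂) n =
      Polynomial.resultant f₁ g m₁ n * Polynomial.resultant f₂ g m₂ n := by
  obtain ⟨c, rfl⟩ := Nat.exists_eq_add_of_le h1
  obtain ⟨d, rfl⟩ := Nat.exists_eq_add_of_le h2
  have : f₁.natDegree + c + (f₂.natDegree + d) = (f₁.natDegree + f₂.natDegree) + (c + d) := by ring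
  rw [this, Polynomial.resultant_add_left_deg _ _ _ _ _ Polynomial.natDegree_mul_le,
    Polynomial.resultant_add_left_deg _ _ _ _ _ le_rfl,
    Polynomial.resultant_add_left_deg _ _ _ _ _ le_rfl, Polynomial.resultant_mul_left _ _ _ _ hg]
  ring

/-! ### Toeplitz matrices -/

/-- The matrix whose columns are the coefficients of `z^t P`, `t < b`, and `z^t Q`, `t < a`. -/
noncomputable def colMat {R : Type*} [CommRing R] (b a : ℕ) (P Q : PowerSeries R) :
    Matrix (Fin (b + a)) (Fin b ⊕ Fin a) R :=
  Matrix.of fun i j => j.elim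
    (fun t : Fin _ => PowerSeries.coeff (i : ℕ) (PowerSeries.X ^ (t : ℕ) * P))
    (fun t : Fin _ => PowerSeries.coeff (i : ℕ) (PowerSeries.X ^ (t : ℕ) * Q))

/-- Lower triangular Toeplitz matrix. -/
noncomputable def toep {R : Type*} [CommRing R] (N : ℕ) (P : PowerSeries R) :
    Matrix (Fin N) (Fin N) R :=
  Matrix.of fun i j => PowerSeries.coeff (i : ℕ) (PowerSeries.X ^ (j : ℕ) * P)

lemma toep_sum {R : Type*} [CommRing R] (N : ℕ) (P Q : PowerSeries R) (i : Fin N) :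
    ∑ j : Fin N, toep N P i j * PowerSeries.coeff (j : ℕ) Q
      = PowerSeries.coeff (i : ℕ) (P * Q) := by
  rw [mul_comm P, PowerSeries.coeff_mul, Finset.Nat.sum_antidiagonal_eq_sum_range_succ
    (fun x y => PowerSeries.coeff x Q * PowerSeries.coeff y P)]
  simp only [toep, Matrix.of_apply, PowerSeries.coeff_X_pow_mul']
  rw [Fin.sum_univ_eq_sum_range (fun j => (if j ≤ (i : ℕ) then
    PowerSeries.coeff ((i : ℕ) - j) P else 0) * PowerSeries.coeff j Q) N]
  symm
  rw [← Finset.sum_subset (s₁ := Finset.range ((i : ℕ) + 1)) (s₂ := Finset.range N)]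
  · refine Finset.sum_congr rfl fun j hj => ?_
    rw [if_pos (by simp at hj; omega), mul_comm]
  · intro j hj
    have := i.2
    simp at hj ⊢; omega
  · intro j _ hj
    rw [if_neg (by simp at hj; omega), zero_mul]

lemma det_toep {R : Type*} [CommRing R] (N : ℕ) (P : PowerSeries R)
    (hP : PowerSeries.coeff 0 P = 1) : (toep N P).det = 1 := by
  rw [Matrix.det_of_isLowerTriangular]
  · refine Finset.prod_eq_one fun i _ => ?_
    simp [toep, PowerSeries.coeff_X_pow_mul', ← hP]
  · intro i j hij
    have : (i : ℕ) < j := hij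
    simp only [toep, Matrix.of_apply, PowerSeries.coeff_X_pow_mul']
    rw [if_neg (by omega)]

lemma toep_mul_colMat {R : Type*} [CommRing R] (b a : ℕ) (S P Q : PowerSeries R) :
    toep (b + a) S * colMat b a P Q = colMat b a (S * P) (S * Q) := by
  ext i j
  rw [Matrix.mul_apply]
  rcases j with t | t
  · simp only [colMat, Matrix.of_apply, Sum.elim_inl]
    rw [toep_sum]
    congr 1; ring
  · simp only [colMat, Matrix.of_apply, Sum.elim_inr]
    rw [toep_sum]
    congr 1; ring

lemma sylvester_eq {R : Type*} [CommRing R] (b a : ℕ) (f g : Polynomial R)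
    (hf : f.natDegree ≤ b) (hg : g.natDegree ≤ a) :
    Polynomial.sylvester f g b a =
      (colMat b a (g : PowerSeries R) (f : PowerSeries R)).submatrix id finSumFinEquiv.symm := by
  ext i j
  induction j using Fin.addCases with
  | left t =>
    simp only [Polynomial.sylvester, Matrix.of_apply, Fin.addCases_left, Matrix.submatrix_apply,
      finSumFinEquiv_symm_apply_castAdd, colMat, Sum.elim_inl, PowerSeries.coeff_X_pow_mul', id,
      Polynomial.coeff_coe, Set.mem_Icc]
    split_ifs with h1 h2 h2
    · rfl
    · omega
    · rw [Polynomial.coeff_eq_zero_of_natDegree_lt]; omega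
    · rfl
  | right t =>
    simp only [Polynomial.sylvester, Matrix.of_apply, Fin.addCases_right, Matrix.submatrix_apply,
      finSumFinEquiv_symm_apply_natAdd, colMat, Sum.elim_inr, PowerSeries.coeff_X_pow_mul', id,
      Polynomial.coeff_coe, Set.mem_Icc]
    split_ifs with h1 h2 h2
    · rfl
    · omega
    · rw [Polynomial.coeff_eq_zero_of_natDegree_lt]; omega
    · rfl

lemma det_colMat {R : Type*} [CommRing R] {a b : ℕ} (A : Fin a → R) (B : Fin b → R) :
    ((colMat b a (PowerSeries.mk (hh B)) (PowerSeries.mk (hh A))).submatrix id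
      finSumFinEquiv.symm).det = Polynomial.resultant (EE B) (EE A) b a := by
  have hA := HH_mul_EE A
  have hB := HH_mul_EE B
  have key := toep_mul_colMat b a (PowerSeries.mk (hh A) * PowerSeries.mk (hh B))
    (EE A : PowerSeries R) (EE B : PowerSeries R)
  have e1 : PowerSeries.mk (hh A) * PowerSeries.mk (hh B) * (EE A : PowerSeries R)
      = PowerSeries.mk (hh B) := by
    rw [mul_right_comm, hA, one_mul]
  have e2 : PowerSeries.mk (hh A) * PowerSeries.mk (hh B) * (EE B : PowerSeries R)
      = PowerSeries.mk (hh A) := by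
    rw [mul_assoc, hB, mul_one]
  rw [e1, e2] at key
  have h0 : ∀ (n : ℕ) (C : Fin n → R), hh C 0 = 1 := by
    intro n C; simp [hh, Finset.Nat.antidiagonalTuple_zero_right]
  rw [Polynomial.resultant, sylvester_eq _ _ _ _ (natDegree_EE_le B) (natDegree_EE_le A), ← key,
    ← Matrix.submatrix_mul_equiv _ _ id (Equiv.refl _) _]
  rw [Matrix.det_mul]
  have : (toep (b + a) (PowerSeries.mk (hh A) * PowerSeries.mk (hh B))).det = 1 :=
    det_toep _ _ (by simp [h0])
  simp [this]

lemma coeff_X_pow_hh {R : Type*} [CommRing R] {n : ℕ} (A : Fin n → R) (s t : ℕ) :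
    PowerSeries.coeff s (PowerSeries.X ^ t * PowerSeries.mk (hh A)) = hZ A ((s : ℤ) - t) := by
  rw [PowerSeries.coeff_X_pow_mul', hZ]
  split_ifs with h1 h2 h2
  · rw [PowerSeries.coeff_mk]; congr 1; omega
  · omega
  · omega
  · rfl

/-! ### Shuffles and Laplace expansion -/

/-- Shuffles: bijections monotone on both blocks. -/
def IsShuf {a b : ℕ} (e : Fin b ⊕ Fin a ≃ Fin (b + a)) : Prop :=
  StrictMono (fun t => e (Sum.inl t)) ∧ StrictMono (fun t => e (Sum.inr t))

lemma range_inl_compl {a b : ℕ} (e : Fin b ⊕ Fin a ≃ Fin (b + a)) :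
    Set.range (fun t => e (Sum.inl t)) = (Set.range (fun t => e (Sum.inr t)))ᶜ := by
  ext k
  obtain ⟨j, rfl⟩ := e.surjective k
  rcases j with t | t <;> simp

lemma IsShuf.ext_inr {a b : ℕ} {e e' : Fin b ⊕ Fin a ≃ Fin (b + a)} (h : IsShuf e)
    (h' : IsShuf e') (hr : Set.range (fun t => e (Sum.inr t)) = Set.range (fun t => e' (Sum.inr t))) :
    e = e' := by
  have hl : Set.range (fun t => e (Sum.inl t)) = Set.range (fun t => e' (Sum.inl t)) := by
    rw [range_inl_compl, range_inl_compl, hr]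
  have h1 := (StrictMono.range_inj h.1 h'.1).1 hl
  have h2 := (StrictMono.range_inj h.2 h'.2).1 hr
  ext j
  rcases j with t | t
  · exact congrArg Fin.val (congrFun h1 t)
  · exact congrArg Fin.val (congrFun h2 t)

/-- sign of a bijection -/
def esign {a b : ℕ} (e : Fin b ⊕ Fin a ≃ Fin (b + a)) : ℤˣ :=
  Equiv.Perm.sign (finSumFinEquiv.symm.trans e)

lemma det_eq_sum_equiv {R : Type*} [CommRing R] {a b : ℕ}
    (M : Matrix (Fin (b + a)) (Fin b ⊕ Fin a) R) :
    (M.submatrix id finSumFinEquiv.symm).det =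
      ∑ e : Fin b ⊕ Fin a ≃ Fin (b + a), ((esign e : ℤ) : R) * ∏ j, M (e j) j := by
  rw [Matrix.det_apply']
  refine Fintype.sum_equiv (Equiv.equivCongr finSumFinEquiv.symm (Equiv.refl _)) _ _ ?_
  intro σ
  congr 1
  · congr 3
    ext; simp
  · refine Fintype.prod_equiv finSumFinEquiv.symm _ _ ?_
    intro i
    simp

lemma esign_sumCongr {a b : ℕ} (e : Fin b ⊕ Fin a ≃ Fin (b + a)) (p : Equiv.Perm (Fin b))
    (q : Equiv.Perm (Fin a)) :
    esign ((Equiv.sumCongr p q).trans e) = Equiv.Perm.sign p * Equiv.Perm.sign q * esign e := by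
  unfold esign
  have : finSumFinEquiv.symm.trans ((Equiv.sumCongr p q).trans e) =
    (finSumFinEquiv.symm.trans e) * (finSumFinEquiv.symm.trans ((Equiv.sumCongr p q).trans finSumFinEquiv) : Equiv.Perm (Fin (b+a))) := by
    ext; simp
  rw [this, Equiv.Perm.sign_mul, mul_comm]
  congr 1
  have h := Equiv.Perm.sign_symm_trans_trans (Equiv.sumCongr p q) (finSumFinEquiv (m := b) (n := a))
  rw [← Equiv.trans_assoc, h, Equiv.Perm.sign_sumCongr]

open Classical in
lemma laplace_s3 {R : Type*} [CommRing R] {a b : ℕ}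
    (M : Matrix (Fin (b + a)) (Fin b ⊕ Fin a) R) :
    (M.submatrix id finSumFinEquiv.symm).det =
      ∑ e : Fin b ⊕ Fin a ≃ Fin (b + a) with IsShuf e, ((esign e : ℤ) : R) *
        (Matrix.of fun i j : Fin b => M (e (Sum.inl i)) (Sum.inl j)).det *
        (Matrix.of fun i j : Fin a => M (e (Sum.inr i)) (Sum.inr j)).det := by
  rw [det_eq_sum_equiv]
  have hterm : ∀ e : Fin b ⊕ Fin a ≃ Fin (b + a), ((esign e : ℤ) : R) *
        (Matrix.of fun i j : Fin b => M (e (Sum.inl i)) (Sum.inl j)).det *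
        (Matrix.of fun i j : Fin a => M (e (Sum.inr i)) (Sum.inr j)).det =
      ∑ x : Equiv.Perm (Fin b) × Equiv.Perm (Fin a), ((esign e : ℤ) : R) *
        ((((Equiv.Perm.sign x.1 : ℤˣ) : ℤ) : R) * ∏ t, M (e (Sum.inl (x.1 t))) (Sum.inl t)) *
        ((((Equiv.Perm.sign x.2 : ℤˣ) : ℤ) : R) * ∏ t, M (e (Sum.inr (x.2 t))) (Sum.inr t)) := by
    intro e
    rw [Matrix.det_apply', Matrix.det_apply', mul_assoc, Finset.sum_mul_sum, Finset.mul_sum,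
      Fintype.sum_prod_type]
    refine Finset.sum_congr rfl fun p _ => ?_
    rw [Finset.mul_sum]
    refine Finset.sum_congr rfl fun q _ => ?_
    simp only [Matrix.of_apply]
    ring
  rw [Finset.sum_congr rfl fun e _ => hterm e, ← Finset.sum_product']
  symm
  refine Finset.sum_bij (fun x _ => (Equiv.sumCongr x.2.1 x.2.2).trans x.1) ?_ ?_ ?_ ?_
  · intros; simp
  · rintro ⟨e, p, q⟩ h ⟨e', p', q'⟩ h' heq
    simp only [Finset.mem_product, Finset.mem_filter, Finset.mem_univ, true_and, and_true] at h h'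
    have h2 : ∀ t, e (Sum.inr (q t)) = e' (Sum.inr (q' t)) := fun t => by
      simpa using congrArg (fun f => f (Sum.inr t)) heq
    have hr : Set.range (fun t => e (Sum.inr t)) = Set.range (fun t => e' (Sum.inr t)) := by
      rw [← q.surjective.range_comp (fun t => e (Sum.inr t)),
        ← q'.surjective.range_comp (fun t => e' (Sum.inr t))]
      exact congrArg Set.range (funext h2)
    obtain rfl := h.ext_inr h' hr
    have h1 : ∀ t, e (Sum.inl (p t)) = e (Sum.inl (p' t)) := fun t => by
      simpa using congrArg (fun f => f (Sum.inl t)) heq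
    have hp : p = p' := by
      ext t; have := h1 t; simp at this; rw [this]
    have hq : q = q' := by
      ext t; have := h2 t; simp at this; rw [this]
    rw [hp, hq]
  · intro e _
    let p := Tuple.sort (fun t => e (Sum.inl t))
    let q := Tuple.sort (fun t => e (Sum.inr t))
    refine ⟨((Equiv.sumCongr p q).trans e, p.symm, q.symm), ?_, ?_⟩
    · simp only [Finset.mem_product, Finset.mem_filter, Finset.mem_univ, true_and, and_true]
      constructor
      · refine (Tuple.monotone_sort (fun t => e (Sum.inl t))).strictMono_of_injective ?_
        intro x y; simp
      · refine (Tuple.monotone_sort (fun t => e (Sum.inr t))).strictMono_of_injective ?_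
        intro x y; simp
    · ext j; rcases j with t | t <;> simp
  · rintro ⟨e, p, q⟩ _
    rw [esign_sumCongr, Fintype.prod_sum_type]
    simp only [Equiv.trans_apply, Equiv.sumCongr_apply, Sum.map_inl, Sum.map_inr, Units.val_mul,
      Int.cast_mul]
    ring

lemma esign_shuf {a b : ℕ} {e : Fin b ⊕ Fin a ≃ Fin (b + a)} (h : IsShuf e) :
    esign e = ∏ t : Fin b, (-1) ^
      (Finset.univ.filter fun i : Fin a => e (Sum.inr i) < e (Sum.inl t)).card := by
  unfold esign
  rw [Equiv.Perm.sign_eq_prod_prod_Ioi]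
  have : ∀ i : Fin (b + a), Finset.Ioi i = Finset.univ.filter (fun j => i < j) := by
    intro i; ext; simp
  simp_rw [this, Finset.prod_filter]
  simp_rw [Fin.prod_univ_add]
  simp only [Equiv.trans_apply, finSumFinEquiv_symm_apply_castAdd,
    finSumFinEquiv_symm_apply_natAdd]
  have hr : ∀ i j : Fin a, (if Fin.natAdd b i < Fin.natAdd b j then
      (if e (Sum.inr i) < e (Sum.inr j) then (1 : ℤˣ) else -1) else 1) = 1 := by
    intro i j
    split_ifs with h1 h2
    · rfl
    · exact absurd (h.2 (by simpa using h1)) h2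
    · rfl
  have hl : ∀ i j : Fin b, (if Fin.castAdd a i < Fin.castAdd a j then
      (if e (Sum.inl i) < e (Sum.inl j) then (1 : ℤˣ) else -1) else 1) = 1 := by
    intro i j
    split_ifs with h1 h2
    · rfl
    · exact absurd (h.1 (show i < j from h1)) h2
    · rfl
  have hrl : ∀ (i : Fin a) (j : Fin b), ¬ (Fin.natAdd b i < Fin.castAdd a j) := by
    intro i j; simp [Fin.lt_def]; omega
  have hlr : ∀ (i : Fin a) (j : Fin b), (Fin.castAdd a j < Fin.natAdd b i) := by
    intro i j; simp [Fin.lt_def]; omega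
  simp only [hr, hl, hrl, hlr, if_true, if_false, Finset.prod_const_one, mul_one, one_mul]
  refine Finset.prod_congr rfl fun t _ => ?_
  rw [Finset.prod_ite, Finset.prod_const_one, one_mul, Finset.prod_const]
  congr 2
  ext i
  simp only [Finset.mem_filter, Finset.mem_univ, true_and, not_lt]
  constructor
  · intro hle
    exact lt_of_le_of_ne hle (by simp)
  · exact le_of_lt

/-- Counting: elements below a value -/
lemma val_eq_card {a b : ℕ} (e : Fin b ⊕ Fin a ≃ Fin (b + a)) (k : Fin (b + a)) :
    (k : ℕ) = (Finset.univ.filter fun t : Fin b => e (Sum.inl t) < k).card +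
      (Finset.univ.filter fun t : Fin a => e (Sum.inr t) < k).card := by
  have h1 : (k : ℕ) = (Finset.univ.filter fun j => e j < k).card := by
    rw [← Fin.card_Iio k]
    symm
    refine Finset.card_bij (fun j _ => e j) ?_ ?_ ?_
    · intro j hj; simpa using hj
    · intro x _ y _ hxy; exact e.injective hxy
    · intro y hy; exact ⟨e.symm y, by simpa using hy, by simp⟩
  conv_lhs => rw [h1]
  simp only [Finset.card_filter, Fintype.sum_sum_type]

lemma val_inl {a b : ℕ} {e : Fin b ⊕ Fin a ≃ Fin (b + a)} (h : IsShuf e) (t : Fin b) :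
    (e (Sum.inl t) : ℕ) = t +
      (Finset.univ.filter fun i : Fin a => e (Sum.inr i) < e (Sum.inl t)).card := by
  conv_lhs => rw [val_eq_card e (e (Sum.inl t))]
  congr 1
  rw [← Fin.card_Iio t]
  congr 1
  ext s
  simp [h.1.lt_iff_lt]

lemma val_inr {a b : ℕ} {e : Fin b ⊕ Fin a ≃ Fin (b + a)} (h : IsShuf e) (i : Fin a) :
    (e (Sum.inr i) : ℕ) = i +
      (Finset.univ.filter fun t : Fin b => e (Sum.inl t) < e (Sum.inr i)).card := by
  conv_lhs => rw [val_eq_card e (e (Sum.inr i))]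
  rw [add_comm]
  congr 1
  rw [← Fin.card_Iio i]
  congr 1
  ext s
  simp [h.2.lt_iff_lt]

/-- The partition attached to a shuffle. -/
def shufPart {a b : ℕ} (e : Fin b ⊕ Fin a ≃ Fin (b + a)) : Fin a → ℕ :=
  fun i => (e (Sum.inr i.rev) : ℕ) - (i.rev : ℕ)

lemma lt_iff_part {a b : ℕ} {e : Fin b ⊕ Fin a ≃ Fin (b + a)} (h : IsShuf e) (i : Fin a)
    (t : Fin b) : e (Sum.inr i) < e (Sum.inl t) ↔ (e (Sum.inr i) : ℕ) - i ≤ t := by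
  have h1 := val_inr h i
  constructor
  · intro hlt
    have : (Finset.univ.filter fun t : Fin b => e (Sum.inl t) < e (Sum.inr i)).card ≤ t := by
      rw [← Fin.card_Iio t]
      refine Finset.card_le_card fun s hs => ?_
      simp only [Finset.mem_filter, Finset.mem_univ, true_and] at hs
      rw [Finset.mem_Iio, ← h.1.lt_iff_lt]
      exact hs.trans hlt
    omega
  · intro hle
    by_contra hnot
    have : (t : ℕ) + 1 ≤ (Finset.univ.filter fun t : Fin b => e (Sum.inl t) < e (Sum.inr i)).card := by
      rw [← Fin.card_Iic t]
      refine Finset.card_le_card fun s hs => ?_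
      simp only [Finset.mem_filter, Finset.mem_univ, true_and]
      rw [Finset.mem_Iic, ← h.1.le_iff_le] at hs
      exact lt_of_le_of_ne (hs.trans (not_lt.1 hnot)) (by simp)
    omega

lemma compTr_shufPart {a b : ℕ} {e : Fin b ⊕ Fin a ≃ Fin (b + a)} (h : IsShuf e) (t : Fin b) :
    compTr a b (shufPart e) t.rev =
      (Finset.univ.filter fun i : Fin a => e (Sum.inr i) < e (Sum.inl t)).card := by
  unfold compTr tr
  congr 1
  ext i
  simp only [Finset.mem_filter, Finset.mem_univ, true_and, boxCompl, shufPart, Fin.rev_rev]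
  rw [lt_iff_part h, Fin.val_rev]
  have := t.2
  omega

lemma shufPart_mem {a b : ℕ} {e : Fin b ⊕ Fin a ≃ Fin (b + a)} (h : IsShuf e) :
    shufPart e ∈ box a b := by
  simp only [_root_.box, Finset.mem_filter, Finset.mem_image, Finset.mem_univ, true_and]
  have hb : ∀ i, shufPart e i ≤ b := by
    intro i
    have h1 := val_inr h i.rev
    have h2 : (Finset.univ.filter fun t : Fin b => e (Sum.inl t) < e (Sum.inr i.rev)).card ≤ b := by
      simpa using Finset.card_le_univ
        (Finset.univ.filter fun t : Fin b => e (Sum.inl t) < e (Sum.inr i.rev))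
    simp only [shufPart]; omega
  refine ⟨⟨fun i => ⟨shufPart e i, Nat.lt_succ_of_le (hb i)⟩, rfl⟩, ?_⟩
  intro i j hij
  have h1 := val_inr h i.rev
  have h2 := val_inr h j.rev
  have h3 : (Finset.univ.filter fun t : Fin b => e (Sum.inl t) < e (Sum.inr j.rev)).card ≤
      (Finset.univ.filter fun t : Fin b => e (Sum.inl t) < e (Sum.inr i.rev)).card := by
    refine Finset.card_le_card fun s hs => ?_
    simp only [Finset.mem_filter, Finset.mem_univ, true_and] at hs ⊢
    exact hs.trans_le (h.2.monotone (Fin.rev_le_rev.2 hij))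
  simp only [shufPart]; omega

lemma shufPart_inj {a b : ℕ} {e e' : Fin b ⊕ Fin a ≃ Fin (b + a)} (h : IsShuf e) (h' : IsShuf e')
    (heq : shufPart e = shufPart e') : e = e' := by
  refine h.ext_inr h' (congrArg Set.range (funext fun i => ?_))
  have h1 := val_inr h i
  have h2 := val_inr h' i
  have h3 := congrFun heq i.rev
  simp only [shufPart, Fin.rev_rev] at h3
  apply Fin.ext; omega

lemma shufPart_surj {a b : ℕ} {α : Fin a → ℕ} (hα : α ∈ box a b) :
    ∃ e : Fin b ⊕ Fin a ≃ Fin (b + a), IsShuf e ∧ shufPart e = α := by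
  simp only [_root_.box, Finset.mem_filter, Finset.mem_image, Finset.mem_univ, true_and] at hα
  obtain ⟨⟨g, rfl⟩, hmono⟩ := hα
  let f : Fin a → Fin (b + a) := fun i => ⟨(g i.rev : ℕ) + i, by
    have := (g i.rev).2; have := i.2; omega⟩
  have hf : StrictMono f := by
    intro i j hij
    have : (g i.rev : ℕ) ≤ g j.rev := hmono j.rev i.rev (Fin.rev_le_rev.2 hij.le)
    have hij' : (i : ℕ) < j := hij
    simp only [f, Fin.lt_def]; omega
  let T : Finset (Fin (b + a)) := Finset.univ.image f
  have hT : T.card = a := by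
    rw [Finset.card_image_of_injective _ hf.injective]; simp
  have hTc : (Tᶜ).card = b := by rw [Finset.card_compl, hT]; simp
  have hTcc : (Tᶜᶜ).card = a := by rw [compl_compl, hT]
  have hfe : f = Tᶜᶜ.orderEmbOfFin hTcc :=
    Finset.orderEmbOfFin_unique hTcc (fun i => by simp [T]) hf
  refine ⟨finSumEquivOfFinset hTc hTcc, ⟨?_, ?_⟩, ?_⟩
  · intro i j hij; simpa using hij
  · intro i j hij; simpa using hij
  · funext i
    simp only [shufPart, finSumEquivOfFinset_inr, ← hfe, f, Fin.rev_rev]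
    omega

lemma schur_rev {R : Type*} [CommRing R] {n ℓ : ℕ} (A : Fin n → R) (α : Fin ℓ → ℕ) (s : Fin ℓ → ℕ)
    (hs : ∀ i, s i = α i.rev + i) :
    (Matrix.of fun i j : Fin ℓ => hZ A ((s i : ℤ) - (j : ℕ))).det = schur A α := by
  unfold schur
  rw [← Matrix.det_submatrix_equiv_self Fin.revPerm]
  congr 1
  ext i j
  simp only [Matrix.submatrix_apply, Matrix.of_apply, Fin.revPerm_apply, hs, Fin.rev_rev,
    Fin.val_rev]
  congr 1
  have := i.2
  have := j.2
  omega

lemma rpoly_eq {R : Type*} [CommRing R] {a b : ℕ} (A : Fin a → R) (B : Fin b → R) :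
    rpoly A B = Polynomial.resultant (EE B) (EE A) b a := by
  classical
  rw [← det_colMat, laplace_s3, rpoly]
  symm
  refine Finset.sum_bij (fun e _ => shufPart e) ?_ ?_ ?_ ?_
  · intro e he
    exact shufPart_mem (by simpa using he)
  · intro e he e' he' h
    exact shufPart_inj (by simpa using he) (by simpa using he') h
  · intro α hα
    obtain ⟨e, he, h⟩ := shufPart_surj hα
    exact ⟨e, by simpa using he, h⟩
  · intro e he
    have he : IsShuf e := by simpa using he
    have hw : wt (compTr a b (shufPart e)) = ∑ t : Fin b,
        (Finset.univ.filter fun i : Fin a => e (Sum.inr i) < e (Sum.inl t)).card := by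
      rw [wt, ← Equiv.sum_comp Fin.revPerm]
      refine Finset.sum_congr rfl fun t _ => ?_
      rw [Fin.revPerm_apply, compTr_shufPart he]
    have hsgn : ((esign e : ℤ) : R) = (-1) ^ wt (compTr a b (shufPart e)) := by
      rw [esign_shuf he, hw, Finset.prod_pow_eq_pow_sum]
      simp
    rw [hsgn, mul_right_comm]
    simp only [colMat, Matrix.of_apply, Sum.elim_inl, Sum.elim_inr, coeff_X_pow_hh]
    rw [schur_rev A (shufPart e) (fun i => (e (Sum.inr i) : ℕ)),
      schur_rev B (compTr a b (shufPart e)) (fun i => (e (Sum.inl i) : ℕ))]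
    · intro i
      rw [compTr_shufPart he]
      have := val_inl he i
      omega
    · intro i
      have := val_inr he i
      simp only [shufPart, Fin.rev_rev]
      omega

/-- `r(𝔸, 𝔹 ⊔ 𝕏) = r(𝔸, 𝔹) · r(𝔸, 𝕏)`, where `𝔹 ⊔ 𝕏` is the
concatenated tuple of length `b + x`. -/
theorem statement3 {R : Type*} [CommRing R] {a b x : ℕ} (A : Fin a → R) (B : Fin b → R)
    (X : Fin x → R) :
    rpoly A (Fin.append B X) = rpoly A B * rpoly A X := by
  rw [rpoly_eq, rpoly_eq, rpoly_eq, EE_append, res_mul_left _ _ _ (natDegree_EE_le B) (natDegree_EE_le X)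
    (natDegree_EE_le A)]
end
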